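/- Let m ≥ 1 be an integer, let ξ₀ < ξ₁ be reals, and let J₀, J₁, J₂ : ℝ² → ℝ be smooth, with 𝓛 the associated operator. Suppose q is a real polynomial in (η,ξ) of total degree at most m such that q(0,ξ) = 0 and ∂_η q(0,ξ) = 0 for all ξ ∈ [ξ₀, ξ₁], and such that for every integer n with 0 ≤ n ≤ m−2 and every univariate real polynomial v of degree at most m−2−n one has ∫_{ξ₀}^{ξ₁} v(ξ)·∂ⁿ_η(𝓛q)(0,ξ) dξ = 0. Then q is the zero polynomial. -/

import Mathlib

open MvPolynomial

/-- Evaluation of a bivariate polynomial at `(η, ξ)`. -/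
noncomputable def evalP (q : MvPolynomial (Fin 2) ℝ) (η ξ : ℝ) : ℝ :=
  MvPolynomial.eval ![η, ξ] q

/-- The second-order operator `𝓛 u = u_ηη + J₀ u_ξξ + J₁ u_η + J₂ u_ξ`
(the Laplacian expressed in Frenet coordinates). -/
noncomputable def Lop (J₀ J₁ J₂ : ℝ → ℝ → ℝ) (u : ℝ → ℝ → ℝ) (η ξ : ℝ) : ℝ :=
  iteratedDeriv 2 (fun t => u t ξ) η
    + J₀ η ξ * iteratedDeriv 2 (fun s => u η s) ξ
    + J₁ η ξ * deriv (fun t => u t ξ) η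
    + J₂ η ξ * deriv (fun s => u η s) ξ

/-- The Frenet interface jump conditions (i)–(iii) for a pair `(qm, qp)` of
bivariate polynomials. -/
def JumpConds (m : ℕ) (ξ₀ ξ₁ βm βp : ℝ) (J₀ J₁ J₂ : ℝ → ℝ → ℝ)
    (qm qp : MvPolynomial (Fin 2) ℝ) : Prop :=
  (∀ ξ ∈ Set.Icc ξ₀ ξ₁, evalP qp 0 ξ = evalP qm 0 ξ) ∧
  (∀ ξ ∈ Set.Icc ξ₀ ξ₁,
    βp * deriv (fun t => evalP qp t ξ) 0 = βm * deriv (fun t => evalP qm t ξ) 0) ∧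
  (∀ n : ℕ, n + 2 ≤ m → ∀ v : Polynomial ℝ, v.natDegree ≤ m - 2 - n →
    ∫ ξ in ξ₀..ξ₁, v.eval ξ *
      (βp * iteratedDeriv n (fun t => Lop J₀ J₁ J₂ (evalP qp) t ξ) 0
        - βm * iteratedDeriv n (fun t => Lop J₀ J₁ J₂ (evalP qm) t ξ) 0) = 0)

open scoped ContDiff

theorem hasDerivAt_evalP_fst (p : MvPolynomial (Fin 2) ℝ) (η ξ : ℝ) :
    HasDerivAt (fun t => evalP p t ξ) (evalP (pderiv 0 p) η ξ) η := by
  unfold evalP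
  induction p using MvPolynomial.induction_on with
  | C a => simpa using hasDerivAt_const η a
  | add p q hp hq =>
    simp only [map_add]
    exact hp.add hq
  | mul_X p i hp =>
    have hX : HasDerivAt (fun t => eval ![t, ξ] (X i : MvPolynomial (Fin 2) ℝ))
        (eval ![η, ξ] (pderiv 0 (X i : MvPolynomial (Fin 2) ℝ))) η := by
      fin_cases i
      · simpa using hasDerivAt_id' η
      · simpa using hasDerivAt_const η ξ
    simp only [map_mul, map_add, pderiv_mul]
    exact hp.mul hX

theorem hasDerivAt_evalP_snd (p : MvPolynomial (Fin 2) ℝ) (η ξ : ℝ) :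
    HasDerivAt (fun s => evalP p η s) (evalP (pderiv 1 p) η ξ) ξ := by
  unfold evalP
  induction p using MvPolynomial.induction_on with
  | C a => simpa using hasDerivAt_const ξ a
  | add p q hp hq =>
    simp only [map_add]
    exact hp.add hq
  | mul_X p i hp =>
    have hX : HasDerivAt (fun s => eval ![η, s] (X i : MvPolynomial (Fin 2) ℝ))
        (eval ![η, ξ] (pderiv 1 (X i : MvPolynomial (Fin 2) ℝ))) ξ := by
      fin_cases i
      · simpa using hasDerivAt_const ξ η
      · simpa using hasDerivAt_id' ξ
    simp only [map_mul, map_add, pderiv_mul]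
    exact hp.mul hX

theorem deriv_evalP_fst (p : MvPolynomial (Fin 2) ℝ) (ξ : ℝ) :
    deriv (fun t => evalP p t ξ) = fun t => evalP (pderiv 0 p) t ξ :=
  funext fun t => (hasDerivAt_evalP_fst p t ξ).deriv

theorem deriv_evalP_snd (p : MvPolynomial (Fin 2) ℝ) (η : ℝ) :
    deriv (fun s => evalP p η s) = fun s => evalP (pderiv 1 p) η s :=
  funext fun s => (hasDerivAt_evalP_snd p η s).deriv

theorem contDiff_evalP_fst (p : MvPolynomial (Fin 2) ℝ) (ξ : ℝ) :
    ContDiff ℝ ∞ (fun t => evalP p t ξ) := by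
  unfold evalP
  induction p using MvPolynomial.induction_on with
  | C a => simpa using contDiff_const
  | add p q hp hq => simpa using hp.add hq
  | mul_X p i hp =>
    have hX : ContDiff ℝ ∞ (fun t => eval ![t, ξ] (X i : MvPolynomial (Fin 2) ℝ)) := by
      fin_cases i
      · simpa using contDiff_fun_id
      · simpa using contDiff_const
    simpa only [map_mul] using hp.mul hX

theorem Lop_evalP (J₀ J₁ J₂ : ℝ → ℝ → ℝ) (q : MvPolynomial (Fin 2) ℝ) (η ξ : ℝ) :
    Lop J₀ J₁ J₂ (evalP q) η ξ =
      evalP (pderiv 0 (pderiv 0 q)) η ξ + J₀ η ξ * evalP (pderiv 1 (pderiv 1 q)) η ξ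
        + J₁ η ξ * evalP (pderiv 0 q) η ξ + J₂ η ξ * evalP (pderiv 1 q) η ξ := by
  simp only [Lop, iteratedDeriv_succ, iteratedDeriv_zero, deriv_evalP_fst, deriv_evalP_snd]

theorem iteratedDeriv_pow_mul_zero (n : ℕ) {G : ℝ → ℝ} (hG : ContDiff ℝ ∞ G) :
    iteratedDeriv n (fun t => t ^ n * G t) 0 = n.factorial * G 0 := by
  induction n generalizing G with
  | zero => simp
  | succ n ih =>
    obtain ⟨hd, hG'⟩ := contDiff_infty_iff_deriv.mp hG
    have hderiv : deriv (fun t => t ^ (n + 1) * G t) =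
        fun t => t ^ n * ((n + 1) * G t + t * deriv G t) := by
      funext t
      have h := (hasDerivAt_pow (n + 1) t).mul (hd t).hasDerivAt
      refine h.deriv.trans ?_
      simp only [Nat.add_sub_cancel]
      push_cast
      ring
    rw [iteratedDeriv_succ', hderiv, ih (by fun_prop), Nat.factorial_succ]
    push_cast
    ring

/-- Only the term `u_ηη` contributes to `∂ⁿ_η (𝓛 u)(0, ξ)` when `u = η ^ (n + 2) r`. -/
theorem iteratedDeriv_Lop_X_pow_mul (J₀ J₁ J₂ : ℝ → ℝ → ℝ)
    (hJ₀ : ContDiff ℝ ∞ (Function.uncurry J₀))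
    (hJ₁ : ContDiff ℝ ∞ (Function.uncurry J₁))
    (hJ₂ : ContDiff ℝ ∞ (Function.uncurry J₂))
    (n : ℕ) (r : MvPolynomial (Fin 2) ℝ) (ξ : ℝ) :
    iteratedDeriv n (fun t => Lop J₀ J₁ J₂ (evalP (X 0 ^ (n + 2) * r)) t ξ) 0 =
      (n + 2).factorial * evalP r 0 ξ := by
  have hJ {J : ℝ → ℝ → ℝ} (h : ContDiff ℝ ∞ (Function.uncurry J)) :
      ContDiff ℝ ∞ fun t => J t ξ := h.comp (contDiff_id.prodMk contDiff_const)
  have h₀ := hJ hJ₀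
  have h₁ := hJ hJ₁
  have h₂ := hJ hJ₂
  have hr := fun p => contDiff_evalP_fst p ξ
  have hL : (fun t => Lop J₀ J₁ J₂ (evalP (X 0 ^ (n + 2) * r)) t ξ) = fun t => t ^ n *
      ((n + 2) * (n + 1) * evalP r t ξ + t * (2 * (n + 2) * evalP (pderiv 0 r) t ξ
        + t * evalP (pderiv 0 (pderiv 0 r)) t ξ
        + J₀ t ξ * (t * evalP (pderiv 1 (pderiv 1 r)) t ξ)
        + J₁ t ξ * ((n + 2) * evalP r t ξ + t * evalP (pderiv 0 r) t ξ)
        + J₂ t ξ * (t * evalP (pderiv 1 r) t ξ))) := by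
    funext t
    have htwo : pderiv 0 (2 : MvPolynomial (Fin 2) ℝ) = 0 := (pderiv 0).map_natCast 2
    rw [Lop_evalP]
    simp [evalP, htwo]
    ring
  rw [hL, iteratedDeriv_pow_mul_zero n (by fun_prop), Nat.factorial_succ, Nat.factorial_succ]
  push_cast
  ring

theorem X_zero_dvd_of_evalP_zero_eq_zero {r : MvPolynomial (Fin 2) ℝ}
    (h : ∀ ξ, evalP r 0 ξ = 0) : X 0 ∣ r := by
  have hdvd : Polynomial.X ∣ finSuccEquiv ℝ 1 r := by
    rw [Polynomial.X_dvd_iff]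
    refine MvPolynomial.funext fun s => ?_
    have hs := eval_eq_eval_mv_eval' s 0 r
    have hcons : (Fin.cons 0 s : Fin 2 → ℝ) = ![0, s 0] := by
      ext i; fin_cases i <;> rfl
    rw [hcons, ← Polynomial.coeff_zero_eq_eval_zero, Polynomial.coeff_map] at hs
    rw [← hs, map_zero]
    exact h (s 0)
  rw [← finSuccEquiv_X_zero] at hdvd
  exact (map_dvd_iff (finSuccEquiv ℝ 1)).mp hdvd

/-- The restriction of a bivariate polynomial to the line `η = 0`. -/
noncomputable def restrictAxis (r : MvPolynomial (Fin 2) ℝ) : Polynomial ℝ :=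
  aeval ![0, Polynomial.X] r

theorem eval_restrictAxis (r : MvPolynomial (Fin 2) ℝ) (ξ : ℝ) :
    (restrictAxis r).eval ξ = evalP r 0 ξ := by
  unfold restrictAxis evalP
  induction r using MvPolynomial.induction_on with
  | C a => simp
  | add p q hp hq => simp [hp, hq]
  | mul_X p i hp =>
    simp only [map_mul, Polynomial.eval_mul, hp, aeval_X, eval_X]
    fin_cases i <;> simp

theorem natDegree_restrictAxis_le (r : MvPolynomial (Fin 2) ℝ) :
    (restrictAxis r).natDegree ≤ r.totalDegree := by
  have h := MvPolynomial.aeval_natDegree_le (m := r.totalDegree) (n := 1) r le_rfl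
    ![0, (Polynomial.X : Polynomial ℝ)] (fun i => by fin_cases i <;> simp)
  simpa [restrictAxis] using h

theorem Polynomial.eq_zero_of_eval_eq_zero_on_Icc {p : Polynomial ℝ} {a b : ℝ} (hab : a < b)
    (h : ∀ x ∈ Set.Icc a b, p.eval x = 0) : p = 0 :=
  p.eq_zero_of_infinite_isRoot ((Set.Icc_infinite hab).mono h)

theorem Polynomial.eq_zero_of_integral_mul_self_eq_zero {p : Polynomial ℝ} {a b : ℝ}
    (hab : a < b) (h : ∫ x in a..b, p.eval x * p.eval x = 0) : p = 0 := by
  refine Polynomial.eq_zero_of_eval_eq_zero_on_Icc hab fun x hx => ?_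
  by_contra hne
  exact h.not_gt <| intervalIntegral.integral_pos hab (by fun_prop)
    (fun y _ => mul_self_nonneg _) ⟨x, hx, mul_self_pos.mpr hne⟩

/-- If a bivariate polynomial `q` of total degree at most `m` satisfies the
homogeneous Frenet interface conditions `q(0,ξ) = 0`, `∂_η q(0,ξ) = 0` on
`[ξ₀, ξ₁]`, and the weak conditions
`∫ v(ξ) · ∂ⁿ_η(𝓛q)(0,ξ) dξ = 0` for all `0 ≤ n ≤ m-2` and all `v` of degree at
most `m-2-n`, then `q = 0`. -/
theorem stmt_3 (m : ℕ) (hm : 1 ≤ m) (ξ₀ ξ₁ : ℝ) (hξ : ξ₀ < ξ₁)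
    (J₀ J₁ J₂ : ℝ → ℝ → ℝ)
    (hJ₀ : ContDiff ℝ (⊤ : ℕ∞) (Function.uncurry J₀))
    (hJ₁ : ContDiff ℝ (⊤ : ℕ∞) (Function.uncurry J₁))
    (hJ₂ : ContDiff ℝ (⊤ : ℕ∞) (Function.uncurry J₂))
    (q : MvPolynomial (Fin 2) ℝ) (hq : q.totalDegree ≤ m)
    (h0 : ∀ ξ ∈ Set.Icc ξ₀ ξ₁, evalP q 0 ξ = 0)
    (h1 : ∀ ξ ∈ Set.Icc ξ₀ ξ₁, deriv (fun t => evalP q t ξ) 0 = 0)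
    (h2 : ∀ n : ℕ, n + 2 ≤ m → ∀ v : Polynomial ℝ, v.natDegree ≤ m - 2 - n →
      ∫ ξ in ξ₀..ξ₁, v.eval ξ *
        iteratedDeriv n (fun t => Lop J₀ J₁ J₂ (evalP q) t ξ) 0 = 0) :
    q = 0 := by
  have hdvd : ∀ k, X 0 ^ k ∣ q := by
    intro k
    induction k with
    | zero => simp
    | succ k ih =>
      obtain ⟨r, rfl⟩ := ih
      suffices hr : restrictAxis r = 0 by
        rw [pow_succ]
        refine mul_dvd_mul_left _ (X_zero_dvd_of_evalP_zero_eq_zero fun ξ => ?_)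
        rw [← eval_restrictAxis, hr, Polynomial.eval_zero]
      by_cases hr0 : r = 0
      · simp [hr0, restrictAxis]
      match k with
      | 0 =>
        refine Polynomial.eq_zero_of_eval_eq_zero_on_Icc hξ fun ξ hmem => ?_
        simpa [eval_restrictAxis] using h0 ξ hmem
      | 1 =>
        refine Polynomial.eq_zero_of_eval_eq_zero_on_Icc hξ fun ξ hmem => ?_
        have h := h1 ξ hmem
        rw [deriv_evalP_fst] at h
        simpa [eval_restrictAxis, evalP, pderiv_mul] using h
      | n + 2 =>
        rw [totalDegree_mul_of_isDomain (pow_ne_zero _ (X_ne_zero 0)) hr0,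
          totalDegree_X_pow] at hq
        have hdeg := natDegree_restrictAxis_le r
        have h := h2 n (by omega) (restrictAxis r) (by omega)
        simp only [iteratedDeriv_Lop_X_pow_mul J₀ J₁ J₂ hJ₀ hJ₁ hJ₂, ← eval_restrictAxis,
          mul_left_comm _ ((n + 2).factorial : ℝ), intervalIntegral.integral_const_mul] at h
        exact Polynomial.eq_zero_of_integral_mul_self_eq_zero hξ
          ((mul_eq_zero.mp h).resolve_left (by positivity))
  by_contra hne
  have h := totalDegree_le_of_dvd_of_isDomain (hdvd (m + 1)) hne
  rw [totalDegree_X_pow] at h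
  omega
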